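/- arXiv:2112.06636 — 8 statements merged into one kernel-verified Lean document; each statement's English description precedes it below -/
import Mathlib

section
/- Let I be a symmetric m×m matrix over 𝔽₂ that is odd, i.e. some diagonal entry of I is nonzero. Let Y be an m×n matrix over 𝔽₂ and suppose that the matrix A = Yᵀ · I · Y is even, i.e. all diagonal entries of A are zero. Then rank A ≤ rank I − 1. -/
open Matrix

lemma aux_alt {n : ℕ} (A : Matrix (Fin n) (Fin n) (ZMod 2)) (hs : A.IsSymm)
    (h : ∀ i, A i i = 0) (w : Fin n → ZMod 2) : w ⬝ᵥ (A *ᵥ w) = 0 := by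
  simp only [dotProduct, mulVec, Finset.mul_sum]
  rw [← Finset.sum_product']
  refine Finset.sum_involution (fun p _ => (p.2, p.1)) ?_ ?_ ?_ ?_
  · rintro ⟨i, j⟩ _
    have : w j * (A j i * w i) = w i * (A i j * w j) := by
      rw [hs.apply i j]; ring
    simp only [this]
    exact CharTwo.add_self_eq_zero _
  · rintro ⟨i, j⟩ _ hne heq
    simp only [Prod.mk.injEq] at heq
    obtain ⟨rfl, -⟩ := heq
    simp [h] at hne
  · simp
  · simp

/-- If `I` is an odd symmetric matrix over `𝔽₂` (some diagonal entry
is nonzero), `Y` is any matrix, and `A = Yᵀ * I * Y` is even (all diagonal entries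
are zero), then `rank A ≤ rank I - 1`. -/
theorem rank_conjugate_even_of_odd {m n : ℕ}
    (I : Matrix (Fin m) (Fin m) (ZMod 2)) (hI : I.IsSymm)
    (hIodd : ∃ i, I i i ≠ 0)
    (Y : Matrix (Fin m) (Fin n) (ZMod 2))
    (A : Matrix (Fin n) (Fin n) (ZMod 2)) (hA : A = Yᵀ * I * Y)
    (hAeven : ∀ i, A i i = 0) :
    A.rank ≤ I.rank - 1 := by
  by_contra hlt
  obtain ⟨i, hi⟩ := hIodd
  apply hi
  have h1 : A.rank ≤ (I * Y).rank := by
    rw [hA, Matrix.mul_assoc]; exact rank_mul_le_right _ _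
  have h2 : I.rank ≤ (I * Y).rank := by omega
  have hle : LinearMap.range (I * Y).mulVecLin ≤ LinearMap.range I.mulVecLin := by
    rw [mulVecLin_mul]; exact LinearMap.range_comp_le_range _ _
  have heq := Submodule.eq_of_le_of_finrank_le hle h2
  have hmem : I *ᵥ Pi.single i 1 ∈ LinearMap.range (I * Y).mulVecLin := by
    rw [heq]; exact ⟨_, rfl⟩
  obtain ⟨w, hw⟩ := hmem
  rw [mulVecLin_apply] at hw
  have hs : A.IsSymm := by
    unfold Matrix.IsSymm
    rw [hA]; simp [Matrix.transpose_mul, hI.eq, Matrix.mul_assoc]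
  have key := aux_alt A hs hAeven w
  have e1 : I i i = Pi.single i 1 ⬝ᵥ (I *ᵥ Pi.single i 1) := by simp
  rw [e1, ← hw, ← mulVec_mulVec, dotProduct_mulVec, ← mulVec_transpose, hI.eq, ← hw, ← key, hA,
    dotProduct_comm, Matrix.mul_assoc, ← mulVec_mulVec w Yᵀ, dotProduct_mulVec w Yᵀ,
    vecMul_transpose]
end

section
/- Let A be a symmetric a×a matrix over 𝔽₂ that is even, i.e. all diagonal entries of A are zero, and let r = rank A. Then r is even, say r = 2g, and there exists a 2g×a matrix Y over 𝔽₂ such that A = Yᵀ · H_g · Y. -/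
open Matrix

/-- The `2g × 2g` matrix over `𝔽₂` formed by `g` diagonal `2 × 2` blocks
`[[0,1],[1,0]]` and zeros elsewhere. -/
def Hg (g : ℕ) : Matrix (Fin (2 * g)) (Fin (2 * g)) (ZMod 2) :=
  Matrix.of fun i j => if i.val / 2 = j.val / 2 ∧ i.val ≠ j.val then 1 else 0

theorem Hg_step {a g : ℕ} (Y : Matrix (Fin (2 * g)) (Fin a) (ZMod 2)) (u v : Fin a → ZMod 2) :
    ∃ Z : Matrix (Fin (2 * (g + 1))) (Fin a) (ZMod 2), ∀ i j,
      (Zᵀ * Hg (g + 1) * Z) i j = (Yᵀ * Hg g * Y) i j + u i * v j + v i * u j := by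
  obtain ⟨Z, z1, z2, z3⟩ : ∃ Z : Matrix (Fin (2 * g + 1 + 1)) (Fin a) (ZMod 2),
      (∀ k i, Z k.castSucc.castSucc i = Y k i) ∧ (∀ i, Z (Fin.last (2 * g)).castSucc i = u i) ∧
      (∀ i, Z (Fin.last (2 * g + 1)) i = v i) :=
    ⟨fun k i => (Fin.snoc (α := fun _ => ZMod 2)
      (Fin.snoc (α := fun _ => ZMod 2) (fun k => Y k i) (u i)) (v i) : Fin (2 * g + 2) → ZMod 2) k,
      by simp, by simp, by simp⟩
  refine ⟨Z, ?_⟩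
  intro i j
  simp only [Matrix.mul_apply, Matrix.transpose_apply]
  change ∑ x : Fin (2 * g + 1 + 1), (∑ y : Fin (2 * g + 1 + 1), Z y i * Hg (g + 1) y x) * Z x j = _
  simp only [Fin.sum_univ_castSucc, z1, z2, z3]
  have h1 : ∀ k l : Fin (2 * g), Hg (g + 1) (k.castSucc.castSucc : Fin (2 * g + 1 + 1))
      (l.castSucc.castSucc : Fin (2 * g + 1 + 1)) = Hg g k l := by
    intro k l; simp [Hg]
  have h2 : ∀ k : Fin (2 * g), Hg (g + 1) (k.castSucc.castSucc : Fin (2 * g + 1 + 1))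
      ((Fin.last (2 * g)).castSucc : Fin (2 * g + 1 + 1)) = 0 := by
    intro k; simp [Hg]; omega
  have h3 : ∀ k : Fin (2 * g), Hg (g + 1) (k.castSucc.castSucc : Fin (2 * g + 1 + 1))
      (Fin.last (2 * g + 1) : Fin (2 * g + 1 + 1)) = 0 := by
    intro k; simp [Hg]; omega
  have h4 : ∀ k : Fin (2 * g), Hg (g + 1) ((Fin.last (2 * g)).castSucc : Fin (2 * g + 1 + 1))
      (k.castSucc.castSucc : Fin (2 * g + 1 + 1)) = 0 := by
    intro k; simp [Hg]; omega
  have h5 : ∀ k : Fin (2 * g), Hg (g + 1) (Fin.last (2 * g + 1) : Fin (2 * g + 1 + 1))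
      (k.castSucc.castSucc : Fin (2 * g + 1 + 1)) = 0 := by
    intro k; simp [Hg]; omega
  have h6 : Hg (g + 1) (Fin.last (2 * g + 1) : Fin (2 * g + 1 + 1))
      (Fin.last (2 * g + 1) : Fin (2 * g + 1 + 1)) = 0 := by
    simp [Hg]
  have h7 : Hg (g + 1) ((Fin.last (2 * g)).castSucc : Fin (2 * g + 1 + 1))
      ((Fin.last (2 * g)).castSucc : Fin (2 * g + 1 + 1)) = 0 := by
    simp [Hg]
  have h8 : Hg (g + 1) ((Fin.last (2 * g)).castSucc : Fin (2 * g + 1 + 1))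
      (Fin.last (2 * g + 1) : Fin (2 * g + 1 + 1)) = 1 := by
    simp [Hg]; omega
  have h9 : Hg (g + 1) (Fin.last (2 * g + 1) : Fin (2 * g + 1 + 1))
      ((Fin.last (2 * g)).castSucc : Fin (2 * g + 1 + 1)) = 1 := by
    simp [Hg]; omega
  simp only [h1, h2, h3, h4, h5, h6, h7, h8, h9]
  simp
  ring

theorem rank_step {a : ℕ} (A B : Matrix (Fin a) (Fin a) (ZMod 2)) (p q : Fin a)
    (hpp : A p p = 0) (hqq : A q q = 0) (hpq : A p q = 1) (hqp : A q p = 1)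
    (hB : ∀ i j, B i j = A i j + A i p * A q j + A i q * A p j) :
    B.rank + 2 ≤ A.rank := by
  let φ : (Fin a → ZMod 2) →ₗ[ZMod 2] (ZMod 2 × ZMod 2) :=
    (LinearMap.proj p).prod (LinearMap.proj q)
  let V := LinearMap.range A.mulVecLin
  let ψ := φ.domRestrict V
  have hcol : ∀ j, A.col j ∈ V := fun j => ⟨Pi.single j 1, by simp⟩
  have hsurj : LinearMap.range ψ = ⊤ := by
    rw [LinearMap.range_eq_top]
    rintro ⟨x, y⟩
    refine ⟨x • ⟨_, hcol q⟩ + y • ⟨_, hcol p⟩, ?_⟩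
    simp [ψ, φ, hpp, hqq, hpq, hqp]
  have hrn := ψ.finrank_range_add_finrank_ker
  rw [hsurj] at hrn
  have h2 : Module.finrank (ZMod 2) (⊤ : Submodule (ZMod 2) (ZMod 2 × ZMod 2)) = 2 := by simp
  rw [h2] at hrn
  have hle : LinearMap.range B.mulVecLin ≤ (LinearMap.ker ψ).map V.subtype := by
    rw [Matrix.range_mulVecLin, Submodule.span_le]
    rintro _ ⟨j, rfl⟩
    have e : B.col j = A.col j + A q j • A.col p + A p j • A.col q := by
      ext i; simp [hB]; ring
    have hm : B.col j ∈ V := by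
      rw [e]
      exact V.add_mem (V.add_mem (hcol _) (V.smul_mem _ (hcol _))) (V.smul_mem _ (hcol _))
    refine ⟨⟨_, hm⟩, ?_, rfl⟩
    simp [ψ, φ, hB, hpp, hqq, hpq, hqp, CharTwo.add_self_eq_zero]
  have h3 := Submodule.finrank_mono hle
  have h4 := Submodule.finrank_map_le V.subtype (LinearMap.ker ψ)
  change Module.finrank _ (LinearMap.range B.mulVecLin) + 2 ≤ Module.finrank _ V
  omega

theorem main_aux {a : ℕ} (n : ℕ) : ∀ (A : Matrix (Fin a) (Fin a) (ZMod 2)), A.IsSymm →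
    (∀ i, A i i = 0) → A.rank ≤ n →
    ∃ g : ℕ, A.rank = 2 * g ∧
      ∃ Y : Matrix (Fin (2 * g)) (Fin a) (ZMod 2), A = Yᵀ * Hg g * Y := by
  induction n with
  | zero =>
    intro A _ _ h
    have h0 : A.rank = 0 := by omega
    refine ⟨0, h0, 0, ?_⟩
    have h1 : LinearMap.range A.mulVecLin = ⊥ := Submodule.finrank_eq_zero.mp h0
    have h2 : A = 0 := by
      ext i j
      have h3 := congrFun (LinearMap.congr_fun (LinearMap.range_eq_bot.mp h1) (Pi.single j 1)) i
      simpa using h3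
    simp [h2]
  | succ n ih =>
    intro A hA hE h
    by_cases h0 : A = 0
    · exact ⟨0, by simp [h0], 0, by simp [h0]⟩
    have : ∃ p q, A p q ≠ 0 := by
      by_contra! hc
      exact h0 (by ext i j; simpa using hc i j)
    obtain ⟨p, q, hpq⟩ := this
    have hpq : A p q = 1 := by
      generalize A p q = x at hpq; revert x; decide
    have hqp : A q p = 1 := by rw [← hpq]; exact hA.apply p q
    let B : Matrix (Fin a) (Fin a) (ZMod 2) :=
      Matrix.of fun i j => A i j + A i p * A q j + A i q * A p j
    have hr := rank_step A B p q (hE p) (hE q) hpq hqp (fun i j => rfl)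
    have hBs : B.IsSymm := by
      ext i j
      simp only [B, Matrix.transpose_apply, Matrix.of_apply]
      rw [hA.apply i j, hA.apply p j, hA.apply i q, hA.apply q j, hA.apply i p]
      ring
    have hBE : ∀ i, B i i = 0 := by
      intro i
      simp only [B, Matrix.of_apply]
      rw [hE, hA.apply i q, hA.apply i p, zero_add, mul_comm, CharTwo.add_self_eq_zero]
    obtain ⟨g, hg, Y, hY⟩ := ih B hBs hBE (by omega)
    obtain ⟨Z, hZ⟩ := Hg_step Y (fun i => A i p) (fun i => A i q)
    have hAZ : A = Zᵀ * Hg (g + 1) * Z := by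
      ext i j
      rw [hZ, ← hY]
      simp only [B, Matrix.of_apply]
      rw [hA.apply j q, hA.apply j p]
      generalize A i j = x, A i p = y, A j p = z, A i q = w, A j q = t
      revert x y z w t
      decide
    refine ⟨g + 1, ?_, Z, hAZ⟩
    have h5 : A.rank ≤ 2 * (g + 1) := by
      rw [hAZ]
      refine (Matrix.rank_mul_le_right _ _).trans ?_
      simpa using Z.rank_le_card_height
    omega

/-- An even symmetric matrix `A` over `𝔽₂` has even rank `2g`, and
can be written as `A = Yᵀ * H_g * Y` for some `2g × a` matrix `Y`. -/
theorem even_symm_matrix_eq_conjugate_Hg {a : ℕ}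
    (A : Matrix (Fin a) (Fin a) (ZMod 2)) (hA : A.IsSymm)
    (hAeven : ∀ i, A i i = 0) :
    ∃ g : ℕ, A.rank = 2 * g ∧
      ∃ Y : Matrix (Fin (2 * g)) (Fin a) (ZMod 2), A = Yᵀ * Hg g * Y := by
  exact main_aux A.rank A hA hAeven le_rfl
end

section
/- Let A be a symmetric a×a matrix over 𝔽₂ that is odd, i.e. some diagonal entry of A is nonzero, and let r = rank A. Then there exists an r×a matrix Y over 𝔽₂ such that A = Yᵀ · Y. -/
open Matrix

lemma aux_sum {n : Type*} [DecidableEq n] (f : n → n → ZMod 2)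
    (hf : ∀ i j, f i j = f j i) (s : Finset n) :
    ∑ i ∈ s, ∑ j ∈ s, f i j = ∑ i ∈ s, f i i := by
  induction s using Finset.induction_on with
  | empty => simp
  | insert b s hb ih =>
    rw [Finset.sum_insert hb, Finset.sum_insert hb, Finset.sum_insert hb]
    have h1 : ∑ i ∈ s, ∑ j ∈ insert b s, f i j = ∑ i ∈ s, f b i + ∑ i ∈ s, f i i := by
      rw [← ih, ← Finset.sum_add_distrib]
      refine Finset.sum_congr rfl fun i _ => ?_
      rw [Finset.sum_insert hb, hf i b]
    rw [h1]
    have h2 : ∑ i ∈ s, f b i + ∑ i ∈ s, f b i = 0 := CharTwo.add_self_eq_zero _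
    linear_combination h2

lemma aux_quad {a : ℕ} (A : Matrix (Fin a) (Fin a) (ZMod 2)) (hA : A.IsSymm)
    (x : Fin a → ZMod 2) : x ⬝ᵥ (A *ᵥ x) = A.diag ⬝ᵥ x := by
  have h := aux_sum (fun i j => x i * (A i j * x j))
    (fun i j => by rw [← hA.apply i j]; ring) Finset.univ
  simp only [dotProduct, mulVec, Finset.mul_sum]
  rw [h]
  refine Finset.sum_congr rfl fun i _ => ?_
  have : ∀ u v : ZMod 2, u * (v * u) = v * u := by decide
  exact this _ _

lemma aux_rank {a : ℕ} (A : Matrix (Fin a) (Fin a) (ZMod 2)) (hA : A.IsSymm)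
    (x : Fin a → ZMod 2) (hx : x ⬝ᵥ (A *ᵥ x) = 1) :
    (A - vecMulVec (A *ᵥ x) (A *ᵥ x)).rank < A.rank := by
  have key : ∀ z, (A - vecMulVec (A *ᵥ x) (A *ᵥ x)) *ᵥ z
      = A *ᵥ z - (x ⬝ᵥ (A *ᵥ z)) • (A *ᵥ x) := by
    intro z
    have h : (A *ᵥ x) ⬝ᵥ z = x ⬝ᵥ (A *ᵥ z) := by
      rw [dotProduct_mulVec, ← mulVec_transpose, hA.eq]
    rw [sub_mulVec, vecMulVec_mulVec, h]
    ext i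
    simp
  have hlt : LinearMap.ker A.mulVecLin <
      LinearMap.ker (A - vecMulVec (A *ᵥ x) (A *ᵥ x)).mulVecLin := by
    rw [SetLike.lt_iff_le_and_exists]
    refine ⟨fun z hz => ?_, x, ?_, ?_⟩
    · have hz' : A *ᵥ z = 0 := by simpa using hz
      rw [LinearMap.mem_ker, mulVecLin_apply, key]; simp [hz']
    · rw [LinearMap.mem_ker, mulVecLin_apply, key]; simp [hx]
    · intro h
      have h' : A *ᵥ x = 0 := by simpa using h
      simp [h'] at hx
  have h1 := Submodule.finrank_lt_finrank_of_lt hlt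
  have h2 := LinearMap.finrank_range_add_finrank_ker A.mulVecLin
  have h3 := LinearMap.finrank_range_add_finrank_ker
    (A - vecMulVec (A *ᵥ x) (A *ᵥ x)).mulVecLin
  unfold Matrix.rank
  omega

lemma aux_step {a : ℕ} (A : Matrix (Fin a) (Fin a) (ZMod 2)) (hA : A.IsSymm)
    (hAodd : ∃ i, A i i ≠ 0) :
    ∃ x, x ⬝ᵥ (A *ᵥ x) = 1 ∧ (A - vecMulVec (A *ᵥ x) (A *ᵥ x) = 0 ∨
      ∃ i, (A - vecMulVec (A *ᵥ x) (A *ᵥ x)) i i ≠ 0) := by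
  have z2 : ∀ u : ZMod 2, u ≠ 0 → u = 1 := by decide
  by_cases h : ∃ x, A.diag ⬝ᵥ x = 1 ∧ A *ᵥ x ≠ A.diag
  · obtain ⟨x, hx, hne⟩ := h
    refine ⟨x, by rw [aux_quad A hA, hx], Or.inr ?_⟩
    obtain ⟨i, hi⟩ := Function.ne_iff.mp hne
    refine ⟨i, ?_⟩
    have : ∀ u v : ZMod 2, u ≠ v → v - u * u ≠ 0 := by decide
    exact this _ _ hi
  · push Not at h
    obtain ⟨i, hi⟩ := hAodd
    have hx : A.diag ⬝ᵥ (Pi.single i 1) = 1 := by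
      simpa using z2 _ hi
    refine ⟨Pi.single i 1, by rw [aux_quad A hA, hx], Or.inl ?_⟩
    rw [h _ hx]
    have hz : ∀ z, A.diag ⬝ᵥ z = 0 → A *ᵥ z = 0 := by
      intro z hz
      have := h (z + Pi.single i 1) (by rw [dotProduct_add, hz, hx, zero_add])
      rw [mulVec_add, h _ hx] at this
      simpa using this
    ext k j
    have hj : A.diag ⬝ᵥ (Pi.single j 1) = A j j := by simp
    have hcol : (A *ᵥ Pi.single j 1) k = A k j := by simp
    rw [Matrix.sub_apply, vecMulVec_apply, ← hcol]
    by_cases h0 : A j j = 0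
    · rw [hz _ (hj.trans h0)]
      simp [h0]
    · rw [h _ (hj.trans (z2 _ h0))]
      simp [z2 _ h0]

lemma aux_main {a : ℕ} (k : ℕ) : ∀ (A : Matrix (Fin a) (Fin a) (ZMod 2)), A.IsSymm →
    A.rank ≤ k → (A = 0 ∨ ∃ i, A i i ≠ 0) →
    ∃ Y : Matrix (Fin k) (Fin a) (ZMod 2), A = Yᵀ * Y := by
  induction k with
  | zero =>
    intro A hA hr h
    rcases h with h | h
    · exact ⟨0, by simp [h]⟩
    · obtain ⟨x, hx, -⟩ := aux_step A hA h
      have := aux_rank A hA x hx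
      omega
  | succ k ih =>
    intro A hA hr h
    rcases h with h | h
    · exact ⟨0, by simp [h]⟩
    · obtain ⟨x, hx, h'⟩ := aux_step A hA h
      have hlt := aux_rank A hA x hx
      have hs : (A - vecMulVec (A *ᵥ x) (A *ᵥ x)).IsSymm := by
        ext i j
        simp [vecMulVec_apply, hA.apply, mul_comm]
      obtain ⟨Y, hY⟩ := ih _ hs (by omega) h'
      refine ⟨Matrix.of (Fin.cons (A *ᵥ x) Y), ?_⟩
      ext i j
      have e := congrFun (congrFun hY i) j
      rw [Matrix.sub_apply, vecMulVec_apply, mul_apply] at e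
      rw [mul_apply, Fin.sum_univ_succ]
      simp only [transpose_apply] at e
      change A i j = (A *ᵥ x) i * (A *ᵥ x) j + ∑ l, Y l i * Y l j
      rw [← e]
      ring

/-- An odd symmetric matrix `A` over `𝔽₂` (some diagonal entry
nonzero) of rank `r` can be written as `A = Yᵀ * Y` for some `r × a` matrix `Y`
(that is, as a conjugate of the `r × r` identity matrix). -/
theorem odd_symm_matrix_eq_conjugate_id {a : ℕ}
    (A : Matrix (Fin a) (Fin a) (ZMod 2)) (hA : A.IsSymm)
    (hAodd : ∃ i, A i i ≠ 0) :
    ∃ Y : Matrix (Fin A.rank) (Fin a) (ZMod 2), A = Yᵀ * Y := by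
  exact aux_main A.rank A hA le_rfl (Or.inr hAodd)
end

section
/- Let A be a skew-symmetric a×a matrix with integer entries (i.e. Aᵀ = −A), and let r be the rank of A over ℚ. Then r is even, say r = 2g, and there exists a 2g×a matrix Y with integer entries such that A = Yᵀ · H_{g,ℤ} · Y. -/
open Matrix

/-- The `2g × 2g` integer matrix formed by `g` diagonal `2 × 2` blocks
`[[0,1],[-1,0]]` and zeros elsewhere. -/
def HgZ (g : ℕ) : Matrix (Fin (2 * g)) (Fin (2 * g)) ℤ :=
  Matrix.of fun i j =>
    if i.val / 2 = j.val / 2 then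
      (if i.val + 1 = j.val then 1 else if j.val + 1 = i.val then -1 else 0)
    else 0

/-- The rank over `ℚ` of an integer matrix. -/
noncomputable def rankQ {m n : ℕ} (A : Matrix (Fin m) (Fin n) ℤ) : ℕ :=
  (A.map (Int.cast : ℤ → ℚ)).rank

lemma rank_drop {a : ℕ} (B B' : Matrix (Fin a) (Fin a) ℚ) (x v w : Fin a → ℚ)
    (h1 : ∀ u, B *ᵥ u = 0 → B' *ᵥ u = 0 ∧ x ⬝ᵥ u = 0)
    (hv : B' *ᵥ v = 0) (hxv : x ⬝ᵥ v = 0) (hBv : B *ᵥ v ≠ 0)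
    (hw : B' *ᵥ w = 0) (hxw : x ⬝ᵥ w ≠ 0) : B'.rank + 2 ≤ B.rank := by
  let K : Submodule ℚ (Fin a → ℚ) :=
    LinearMap.ker B'.mulVecLin ⊓ LinearMap.ker (dotProductBilin ℚ ℚ x)
  have hK : ∀ u, u ∈ K ↔ B' *ᵥ u = 0 ∧ x ⬝ᵥ u = 0 := by
    intro u
    simp [K]
  have l1 : LinearMap.ker B.mulVecLin < K := by
    refine SetLike.lt_iff_le_and_exists.2 ⟨fun u hu => (hK u).2 (h1 u (by simpa using hu)),
      v, (hK v).2 ⟨hv, hxv⟩, by simpa using hBv⟩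
  have l2 : K < LinearMap.ker B'.mulVecLin := by
    refine SetLike.lt_iff_le_and_exists.2 ⟨fun u hu => by simpa using ((hK u).1 hu).1,
      w, by simpa using hw, fun h => hxw ((hK w).1 h).2⟩
  have f1 := Submodule.finrank_lt_finrank_of_lt l1
  have f2 := Submodule.finrank_lt_finrank_of_lt l2
  have e1 := LinearMap.finrank_range_add_finrank_ker B.mulVecLin
  have e2 := LinearMap.finrank_range_add_finrank_ker B'.mulVecLin
  unfold Matrix.rank
  omega

lemma skew_step {a : ℕ} (A : Matrix (Fin a) (Fin a) ℤ) (hA : Aᵀ = -A) (h0 : A ≠ 0) :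
    ∃ (x y : Fin a → ℤ) (A' : Matrix (Fin a) (Fin a) ℤ), A'ᵀ = -A' ∧
      (∀ p q, A p q = A' p q + (x p * y q - y p * x q)) ∧ rankQ A' + 2 ≤ rankQ A := by
  have hs : ∀ p q, A p q = - A q p := fun p q => by
    have := congrFun (congrFun hA q) p
    simpa using this
  obtain ⟨i, j, hij⟩ : ∃ i j, A i j ≠ 0 := by
    by_contra! h
    exact h0 (by ext i j; simpa using h i j)
  obtain ⟨d, hd⟩ := (IsPrincipalIdealRing.principal (Ideal.span (Set.range (A i)))).principal
  have hdm : d ∈ Ideal.span (Set.range (A i)) := by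
    rw [hd]; exact Submodule.mem_span_singleton_self d
  obtain ⟨c, hc⟩ := (Ideal.mem_span_range_iff_exists_fun).1 hdm
  have hdiv : ∀ q, ∃ t, A i q = d * t := by
    intro q
    have : A i q ∈ Ideal.span (Set.range (A i)) := Ideal.subset_span ⟨q, rfl⟩
    rw [hd] at this
    exact Ideal.mem_span_singleton.1 this
  choose x hx using hdiv
  have hd0 : d ≠ 0 := by
    rintro rfl
    exact hij (by simp [hx])
  have hcx : ∑ q, x q * c q = 1 := by
    apply mul_left_cancel₀ hd0
    rw [Finset.mul_sum, mul_one]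
    conv_rhs => rw [← hc]
    refine Finset.sum_congr rfl fun q _ => ?_
    rw [hx]; ring
  have hxi : x i = 0 := by
    have h1 := hs i i
    have h2 : A i i = 0 := by omega
    rw [hx] at h2
    exact (mul_eq_zero.1 h2).resolve_left hd0
  let y : Fin a → ℤ := fun q => ∑ k, c k * A k q
  have hyi : y i = -d := by
    simp only [y]
    rw [← hc, ← Finset.sum_neg_distrib]
    refine Finset.sum_congr rfl fun q _ => ?_
    rw [hs]; ring
  have hAc : ∀ p, ∑ q, A p q * c q = - y p := by
    intro p
    simp only [y]
    rw [← Finset.sum_neg_distrib]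
    refine Finset.sum_congr rfl fun q _ => ?_
    rw [hs]; ring
  have hyc : ∑ q, y q * c q = 0 := by
    have e1 : ∑ q, y q * c q = ∑ q, ∑ k, c k * A k q * c q := by
      simp only [y, Finset.sum_mul]
    have e2 : ∑ q, ∑ k, c k * A k q * c q = - ∑ q, ∑ k, c k * A k q * c q := by
      conv_lhs => rw [Finset.sum_comm]
      rw [← Finset.sum_neg_distrib]
      refine Finset.sum_congr rfl fun q _ => ?_
      rw [← Finset.sum_neg_distrib]
      refine Finset.sum_congr rfl fun k _ => ?_
      rw [hs]; ring
    omega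
  let A' : Matrix (Fin a) (Fin a) ℤ := Matrix.of fun p q => A p q - (x p * y q - y p * x q)
  refine ⟨x, y, A', ?_, fun p q => by simp [A'], ?_⟩
  · ext p q
    simp only [A', Matrix.transpose_apply, Matrix.neg_apply, Matrix.of_apply]
    rw [hs q p]; ring
  · unfold rankQ
    refine rank_drop _ _ (fun q => (x q : ℚ)) (Pi.single i 1) (fun q => (c q : ℚ)) ?_ ?_ ?_ ?_ ?_ ?_
    · intro u hu
      have hu' : ∀ p, ∑ q, (A p q : ℚ) * u q = 0 := fun p => by
        have := congrFun hu p
        simpa [Matrix.mulVec, dotProduct] using this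
      have hxu : ∑ q, (x q : ℚ) * u q = 0 := by
        have hdq : (d : ℚ) ≠ 0 := by exact_mod_cast hd0
        apply mul_left_cancel₀ hdq
        rw [Finset.mul_sum, mul_zero, ← hu' i]
        refine Finset.sum_congr rfl fun q _ => ?_
        rw [hx]; push_cast; ring
      have hyu : ∑ q, (y q : ℚ) * u q = 0 := by
        simp only [y]
        push_cast
        simp only [Finset.sum_mul]
        rw [Finset.sum_comm]
        refine Finset.sum_eq_zero fun k _ => ?_
        have := congrArg (fun t => (c k : ℚ) * t) (hu' k)
        simp only [Finset.mul_sum, mul_zero] at this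
        rw [← this]
        refine Finset.sum_congr rfl fun q _ => ?_
        ring
      refine ⟨?_, hxu⟩
      ext p
      have : ∑ q, ((A p q : ℚ) - (x p * y q - y p * x q)) * u q
          = ∑ q, (A p q : ℚ) * u q - (x p * ∑ q, (y q : ℚ) * u q - y p * ∑ q, (x q : ℚ) * u q) := by
        simp only [Finset.mul_sum, ← Finset.sum_sub_distrib]
        refine Finset.sum_congr rfl fun q _ => ?_
        ring
      rw [hu', hxu, hyu] at this
      simpa [Matrix.mulVec, dotProduct, A'] using this
    · ext p
      have : A' p i = 0 := by
        simp only [A', Matrix.of_apply, hxi, hyi]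
        rw [hs, hx]; ring
      simp [this]
    · simp [hxi]
    · intro h
      have h2 := congrFun h j
      have : A j i ≠ 0 := by rw [hs]; simpa using hij
      simp at h2
      exact this h2
    · ext p
      have : ∑ q, A' p q * c q = 0 := by
        have : ∑ q, A' p q * c q
          = ∑ q, A p q * c q - (x p * ∑ q, y q * c q - y p * ∑ q, x q * c q) := by
          simp only [Finset.mul_sum, ← Finset.sum_sub_distrib]
          refine Finset.sum_congr rfl fun q _ => ?_
          simp only [A', Matrix.of_apply]
          ring
        rw [this, hAc, hyc, hcx]; ring
      have := congrArg (Int.cast : ℤ → ℚ) this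
      push_cast at this
      simpa [Matrix.mulVec, dotProduct] using this
    · have := congrArg (Int.cast : ℤ → ℚ) hcx
      push_cast at this
      simp [dotProduct, this]

lemma skew_decomp {a : ℕ} (n : ℕ) : ∀ (A : Matrix (Fin a) (Fin a) ℤ), Aᵀ = -A → rankQ A ≤ n →
    ∃ (g : ℕ) (x y : ℕ → Fin a → ℤ), 2 * g ≤ rankQ A ∧
      ∀ p q, A p q = ∑ k ∈ Finset.range g, (x k p * y k q - y k p * x k q) := by
  induction n with
  | zero =>
    intro A hA hr
    by_cases h0 : A = 0
    · exact ⟨0, 0, 0, by simp, by simp [h0]⟩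
    · obtain ⟨x, y, A', _, _, h⟩ := skew_step A hA h0
      omega
  | succ n ih =>
    intro A hA hr
    by_cases h0 : A = 0
    · exact ⟨0, 0, 0, by simp, by simp [h0]⟩
    · obtain ⟨x, y, A', hA', hxy, h⟩ := skew_step A hA h0
      obtain ⟨g, X, Y, hg, hXY⟩ := ih A' hA' (by omega)
      refine ⟨g + 1, fun k => if k = g then x else X k, fun k => if k = g then y else Y k,
        by omega, fun p q => ?_⟩
      rw [Finset.sum_range_succ, hxy, hXY]
      simp only [if_true]
      congr 1
      refine Finset.sum_congr rfl fun k hk => ?_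
      have : k ≠ g := (Finset.mem_range.1 hk).ne
      simp [this]

lemma HgZ_conj {a g : ℕ} (x y : ℕ → Fin a → ℤ) (p q : Fin a) :
    let Y : Matrix (Fin (2 * g)) (Fin a) ℤ :=
      Matrix.of fun r => if r.val % 2 = 0 then x (r.val / 2) else y (r.val / 2)
    (Yᵀ * HgZ g * Y) p q = ∑ k ∈ Finset.range g, (x k p * y k q - y k p * x k q) := by
  intro Y
  let e : Fin g × Fin 2 ≃ Fin (2 * g) := finProdFinEquiv.trans (finCongr (mul_comm _ _))
  have he : ∀ k b, (e (k, b)).val = b.val + 2 * k.val := fun k b => by simp [e]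
  have hH : ∀ k b l c, HgZ g (e (k, b)) (e (l, c)) =
      if k = l then (!![0, 1; -1, 0] : Matrix (Fin 2) (Fin 2) ℤ) b c else 0 := by
    intro k b l c
    simp only [HgZ, Matrix.of_apply, he, Fin.ext_iff]
    have h1 : (b.val + 2 * k.val) / 2 = k.val := by omega
    have h2 : (c.val + 2 * l.val) / 2 = l.val := by omega
    rw [h1, h2]
    split_ifs with h h' h' <;> fin_cases b <;> fin_cases c <;> simp_all <;> omega
  have hY0 : ∀ k, Y (e (k, 0)) = x k := fun k => by
    ext t
    simp [Y, he]
  have hY1 : ∀ k, Y (e (k, 1)) = y k := fun k => by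
    ext t
    have h1 : (1 + 2 * k.val) / 2 = k.val := by omega
    have h2 : (1 + 2 * k.val) % 2 = 1 := by omega
    simp [Y, he, h1, h2]
  rw [Matrix.mul_assoc, Matrix.mul_apply, ← e.sum_comp, Fintype.sum_prod_type,
    Finset.sum_range]
  refine Finset.sum_congr rfl fun k _ => ?_
  have : ∀ b, (HgZ g * Y) (e (k, b)) q =
      ∑ c, (!![0, 1; -1, 0] : Matrix (Fin 2) (Fin 2) ℤ) b c * Y (e (k, c)) q := by
    intro b
    rw [Matrix.mul_apply, ← e.sum_comp, Fintype.sum_prod_type]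
    rw [Finset.sum_eq_single k]
    · simp [hH]
    · intro l _ hl
      simp [hH, hl.symm]
    · simp
  simp only [this, Fin.sum_univ_two, Matrix.transpose_apply, hY0, hY1]
  simp
  ring

/-- A skew-symmetric integer matrix `A` has even rank `2g` over `ℚ`,
and can be written as `A = Yᵀ * H_{g,ℤ} * Y` for some `2g × a` integer matrix `Y`. -/
theorem skew_symm_int_matrix_eq_conjugate_HgZ {a : ℕ}
    (A : Matrix (Fin a) (Fin a) ℤ) (hA : Aᵀ = -A) :
    ∃ g : ℕ, rankQ A = 2 * g ∧
      ∃ Y : Matrix (Fin (2 * g)) (Fin a) ℤ, A = Yᵀ * HgZ g * Y := by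
  obtain ⟨g, x, y, hg, hxy⟩ := skew_decomp (rankQ A) A hA le_rfl
  let Y : Matrix (Fin (2 * g)) (Fin a) ℤ :=
    Matrix.of fun r => if r.val % 2 = 0 then x (r.val / 2) else y (r.val / 2)
  have hY : A = Yᵀ * HgZ g * Y := by
    ext p q
    rw [hxy, ← HgZ_conj]
  refine ⟨g, le_antisymm ?_ hg, Y, hY⟩
  have h2 : A.map (Int.cast : ℤ → ℚ) =
      (Yᵀ * HgZ g).map (Int.cast : ℤ → ℚ) * Y.map (Int.cast : ℤ → ℚ) := by
    conv_lhs => rw [hY]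
    exact Matrix.map_mul (f := Int.castRingHom ℚ)
  unfold rankQ
  rw [h2]
  exact (Matrix.rank_mul_le_right _ _).trans (Matrix.rank_le_height _)
end

section
/- Let A be a symmetric n×n matrix with integer entries whose rank over ℚ equals 1, and suppose that every diagonal entry of A is the square of an integer. Then there exists a vector b ∈ ℤⁿ such that A_{i,j} = b_i · b_j for all i, j (i.e. A = bᵀ · b). -/
/-- A symmetric integer matrix of rank 1 over `ℚ`, all of whose
diagonal entries are squares of integers, has the form `A = bᵀ * b` for some
integer vector `b`, i.e. `A i j = b i * b j`. -/
theorem rank_one_symm_int_sq_diag {n : ℕ}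
    (A : Matrix (Fin n) (Fin n) ℤ) (hA : A.IsSymm)
    (hrk : rankQ A = 1)
    (hdiag : ∀ i, ∃ c : ℤ, A i i = c ^ 2) :
    ∃ b : Fin n → ℤ, ∀ i j, A i j = b i * b j := by
  have minor : ∀ i j k l, A i j * A k l = A i l * A k j := by
    unfold rankQ at hrk
    rw [Matrix.rank_eq_finrank_span_cols, finrank_eq_one_iff'] at hrk
    obtain ⟨v, -, hv⟩ := hrk
    have key : ∀ j, ∃ c : ℚ, ∀ i, (A i j : ℚ) = c * v.1 i := by
      intro j
      obtain ⟨c, hc⟩ := hv ⟨(A.map (Int.cast : ℤ → ℚ)).col j,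
        Submodule.subset_span ⟨j, rfl⟩⟩
      refine ⟨c, fun i => ?_⟩
      have h := congrFun (congrArg Subtype.val hc) i
      simpa using h.symm
    intro i j k l
    obtain ⟨c, hc⟩ := key j
    obtain ⟨d, hd⟩ := key l
    have : (A i j : ℚ) * A k l = A i l * A k j := by
      rw [hc, hc, hd, hd]; ring
    exact_mod_cast this
  choose c hc using hdiag
  by_cases h0 : ∀ i, c i = 0
  · refine ⟨fun _ => 0, fun i j => ?_⟩
    have h := minor i j j i
    rw [hA.apply i j, hc i, h0 i] at h
    have : A i j * A i j = 0 := by rw [h]; ring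
    simpa using this
  · push Not at h0
    obtain ⟨p, hp⟩ := h0
    have hd : ∀ i, c p ∣ A i p := by
      intro i
      have h := minor i p p i
      rw [hA.apply i p, hc i, hc p] at h
      rw [← Int.pow_dvd_pow_iff (n := 2) (by norm_num)]
      exact ⟨c i ^ 2, by rw [pow_two (A i p), h]; ring⟩
    choose b hb using hd
    refine ⟨b, fun i j => ?_⟩
    have h := minor i j p p
    rw [hA.apply j p, hc p, hb i, hb j] at h
    have h2 : c p ^ 2 ≠ 0 := pow_ne_zero 2 hp
    apply mul_right_cancel₀ h2
    rw [h]; ring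
end

section
/- Let I be a symmetric m×m matrix over 𝔽₂ that is even, i.e. all diagonal entries of I are zero, and let A be a symmetric n×n matrix over 𝔽₂ that is even and satisfies rank A ≤ rank I. Then there exists an m×n matrix Y over 𝔽₂ such that A = Yᵀ · I · Y. -/
open Matrix

lemma ev_add_self {a b : Type*} (M : Matrix a b (ZMod 2)) : M + M = 0 := by
  ext i j; exact CharTwo.add_self_eq_zero _

def evJ : Matrix (Fin 2) (Fin 2) (ZMod 2) := !![0, 1; 1, 0]

lemma evJ_mul : evJ * evJ = 1 := by decide

lemma evJ_tr : evJᵀ = evJ := by decide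

/-- the columns `e_p, e_q` -/
def evE {m : ℕ} (p q : Fin m) : Matrix (Fin m) (Fin 2) (ZMod 2) :=
  (1 : Matrix (Fin m) (Fin m) (ZMod 2)).submatrix id ![p, q]

lemma mul_evE {m : ℕ} (I : Matrix (Fin m) (Fin m) (ZMod 2)) (p q : Fin m) :
    I * evE p q = I.submatrix id ![p, q] := by
  ext i j
  simp [evE, Matrix.mul_apply, Matrix.one_apply]

lemma evE_mul_evE {m : ℕ} (I : Matrix (Fin m) (Fin m) (ZMod 2)) (p q : Fin m) (hI : I.IsSymm)
    (hIeven : ∀ i, I i i = 0) (h : I p q = 1) : (evE p q)ᵀ * (I * evE p q) = evJ := by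
  have h' : I q p = 1 := by rw [← h]; exact hI.apply p q
  rw [mul_evE]
  have key : (evE p q)ᵀ * I.submatrix id ![p, q] = I.submatrix ![p, q] ![p, q] := by
    ext i j
    simp only [evE, Matrix.mul_apply, Matrix.one_apply, transpose_apply, submatrix_apply, id]
    simp
  rw [key]
  ext i j
  simp only [submatrix_apply]
  fin_cases i <;> fin_cases j <;> simp [evJ, h, h', hIeven]

/-- the reduced matrix -/
def evR {m : ℕ} (I : Matrix (Fin m) (Fin m) (ZMod 2)) (p q : Fin m) :
    Matrix (Fin m) (Fin m) (ZMod 2) := I + (I * evE p q) * evJ * (I * evE p q)ᵀ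

lemma evR_symm {m : ℕ} (I : Matrix (Fin m) (Fin m) (ZMod 2)) (p q : Fin m) (hI : I.IsSymm) :
    (evR I p q).IsSymm := by
  unfold Matrix.IsSymm evR
  rw [transpose_add, hI.eq, transpose_mul _ (I * evE p q)ᵀ,
    transpose_mul _ evJ, transpose_transpose, evJ_tr,
    Matrix.mul_assoc (I * evE p q)]

lemma evR_even {m : ℕ} (I : Matrix (Fin m) (Fin m) (ZMod 2)) (p q : Fin m)
    (hIeven : ∀ i, I i i = 0) (i : Fin m) : (evR I p q) i i = 0 := by
  unfold evR
  rw [mul_evE]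
  simp only [Matrix.add_apply, Matrix.mul_apply, hIeven, Fin.sum_univ_two, transpose_apply,
    submatrix_apply]
  simp [evJ]
  rw [mul_comm]; exact CharTwo.add_self_eq_zero _

lemma evR_mul {m : ℕ} (I : Matrix (Fin m) (Fin m) (ZMod 2)) (p q : Fin m) (hI : I.IsSymm)
    (hIeven : ∀ i, I i i = 0) (h : I p q = 1) : evR I p q * evE p q = 0 := by
  have h1 : (I * evE p q)ᵀ * evE p q = evJ := by
    rw [transpose_mul, hI.eq, Matrix.mul_assoc, evE_mul_evE I p q hI hIeven h]
  unfold evR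
  rw [Matrix.add_mul, Matrix.mul_assoc _ _ (evE p q), h1, Matrix.mul_assoc _ evJ, evJ_mul,
    Matrix.mul_one, ev_add_self]

lemma ev_rank_add_le {m : ℕ} (A B : Matrix (Fin m) (Fin m) (ZMod 2)) :
    (A + B).rank ≤ A.rank + B.rank := by
  unfold Matrix.rank
  refine le_trans (Submodule.finrank_mono ?_)
    (Submodule.finrank_add_le_finrank_add_finrank _ _)
  rintro _ ⟨x, rfl⟩
  rw [Matrix.mulVecLin_add]
  exact Submodule.add_mem_sup ⟨x, rfl⟩ ⟨x, rfl⟩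

lemma evR_rank_ge {m : ℕ} (I : Matrix (Fin m) (Fin m) (ZMod 2)) (p q : Fin m) :
    I.rank ≤ (evR I p q).rank + 2 := by
  have h : I = evR I p q + (I * evE p q) * evJ * (I * evE p q)ᵀ := by
    conv_rhs => rw [evR, add_assoc, ev_add_self, add_zero]
  have h2 : ((I * evE p q) * evJ * (I * evE p q)ᵀ).rank ≤ 2 := by
    rw [Matrix.mul_assoc]
    refine (rank_mul_le_left _ _).trans ?_
    exact rank_le_width _
  calc I.rank = _ := congrArg Matrix.rank h
    _ ≤ _ := ev_rank_add_le _ _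
    _ ≤ _ := by omega

lemma evR_rank_le {m : ℕ} (I : Matrix (Fin m) (Fin m) (ZMod 2)) (p q : Fin m) (hI : I.IsSymm)
    (hIeven : ∀ i, I i i = 0) (h : I p q = 1) : (evR I p q).rank + 2 ≤ I.rank := by
  have hz := evR_mul I p q hI hIeven h
  rw [mul_evE] at hz
  have hs := evR_symm I p q hI
  have hp : ∀ j, evR I p q p j = 0 := fun j => by
    rw [← hs.apply]; simpa using congrFun (congrFun hz j) 0
  have hq : ∀ j, evR I p q q j = 0 := fun j => by
    rw [← hs.apply]; simpa using congrFun (congrFun hz j) 1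
  have h' : I q p = 1 := by rw [← h]; exact hI.apply p q
  let X1 : Submodule (ZMod 2) (Fin m → ZMod 2) :=
    LinearMap.range I.mulVecLin ⊓ LinearMap.ker (LinearMap.proj p)
  have l1 : LinearMap.range (evR I p q).mulVecLin < X1 := by
    refine lt_of_le_of_ne ?_ ?_
    · rintro _ ⟨x, rfl⟩
      refine ⟨⟨x + evE p q *ᵥ (evJ *ᵥ ((I * evE p q)ᵀ *ᵥ x)), ?_⟩, ?_⟩
      · simp only [evR, Matrix.mulVecLin_apply, Matrix.add_mulVec, Matrix.mulVec_add,
          Matrix.mulVec_mulVec, Matrix.mul_assoc]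
      · simp [Matrix.mulVec, dotProduct, hp]
    · intro e
      have : I.col p ∈ X1 := ⟨⟨Pi.single p 1, by simp⟩, by simp [hIeven]⟩
      rw [← e] at this
      obtain ⟨x, hx⟩ := this
      have := congrFun hx q
      simp [Matrix.mulVec, dotProduct, hq, h'] at this
  have l2 : X1 < LinearMap.range I.mulVecLin := by
    refine lt_of_le_of_ne inf_le_left ?_
    intro e
    have : I.col q ∈ X1 := by rw [e]; exact ⟨Pi.single q 1, by simp⟩
    have := this.2
    simp [h] at this
  have := Submodule.finrank_lt_finrank_of_lt l1
  have := Submodule.finrank_lt_finrank_of_lt l2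
  unfold Matrix.rank
  omega

lemma ev_exists {m : ℕ} (I : Matrix (Fin m) (Fin m) (ZMod 2)) (h : I ≠ 0) :
    ∃ p q, I p q = 1 := by
  by_contra! hc
  apply h
  ext i j
  have := hc i j
  rw [Matrix.zero_apply]
  generalize I i j = x at this ⊢
  clear hc h
  revert x
  decide

lemma ev_step {m n : ℕ} (I : Matrix (Fin m) (Fin m) (ZMod 2)) (p q : Fin m) (hI : I.IsSymm)
    (hIeven : ∀ i, I i i = 0) (h : I p q = 1) (Y : Matrix (Fin m) (Fin n) (ZMod 2))
    (B : Matrix (Fin n) (Fin 2) (ZMod 2)) :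
    ∃ Z : Matrix (Fin m) (Fin n) (ZMod 2),
      Zᵀ * I * Z = Yᵀ * evR I p q * Y + B * evJ * Bᵀ := by
  obtain ⟨P, hP⟩ : ∃ P, P = 1 + evE p q * evJ * (I * evE p q)ᵀ := ⟨_, rfl⟩
  have hz := evR_mul I p q hI hIeven h
  have h1 : I * P = evR I p q := by
    rw [hP, evR, Matrix.mul_add, Matrix.mul_one]; simp only [Matrix.mul_assoc]
  have h2 : Pᵀ * I = evR I p q := by
    have := congrArg transpose h1
    rwa [transpose_mul, hI.eq, (evR_symm I p q hI).eq] at this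
  have h3 : Pᵀ * I * P = evR I p q := by
    rw [h2, hP, Matrix.mul_add, Matrix.mul_one, ← Matrix.mul_assoc, ← Matrix.mul_assoc, hz]
    simp
  have hz' : (evE p q)ᵀ * evR I p q = 0 := by
    have := congrArg transpose hz
    rwa [transpose_mul, (evR_symm I p q hI).eq, transpose_zero] at this
  refine ⟨P * Y + evE p q * Bᵀ, ?_⟩
  have e1 : (P * Y)ᵀ * I * (P * Y) = Yᵀ * evR I p q * Y := by
    rw [← h3, transpose_mul]; simp only [Matrix.mul_assoc]
  have e2 : (P * Y)ᵀ * I * (evE p q * Bᵀ) = 0 := by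
    rw [transpose_mul, Matrix.mul_assoc Yᵀ, h2, Matrix.mul_assoc, ← Matrix.mul_assoc _ _ Bᵀ, hz]
    simp
  have e3 : (evE p q * Bᵀ)ᵀ * I * (P * Y) = 0 := by
    rw [Matrix.mul_assoc, ← Matrix.mul_assoc I, h1, transpose_mul, Matrix.mul_assoc,
      ← Matrix.mul_assoc _ _ Y, hz']
    simp
  have e4 : (evE p q * Bᵀ)ᵀ * I * (evE p q * Bᵀ) = B * evJ * Bᵀ := by
    rw [← evE_mul_evE I p q hI hIeven h, transpose_mul, transpose_transpose]
    simp only [Matrix.mul_assoc]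
  rw [transpose_add, Matrix.add_mul, Matrix.add_mul, Matrix.mul_add, Matrix.mul_add, e1, e2, e3, e4]
  simp

lemma ev_main (k : ℕ) : ∀ {m n : ℕ}
    (I : Matrix (Fin m) (Fin m) (ZMod 2)) (_ : I.IsSymm)
    (_ : ∀ i, I i i = 0)
    (A : Matrix (Fin n) (Fin n) (ZMod 2)) (_ : A.IsSymm)
    (_ : ∀ i, A i i = 0)
    (_ : A.rank ≤ I.rank) (_ : A.rank ≤ k),
    ∃ Y : Matrix (Fin m) (Fin n) (ZMod 2), A = Yᵀ * I * Y := by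
  induction k with
  | zero =>
    intro m n I hI hIe A hA hAe hr hk
    by_cases h0 : A = 0
    · exact ⟨0, by simp [h0]⟩
    obtain ⟨p, q, h⟩ := ev_exists A h0
    have := evR_rank_le A p q hA hAe h
    omega
  | succ k ih =>
    intro m n I hI hIe A hA hAe hr hk
    by_cases h0 : A = 0
    · exact ⟨0, by simp [h0]⟩
    obtain ⟨p, q, h⟩ := ev_exists A h0
    have r1 := evR_rank_le A p q hA hAe h
    have hI0 : I ≠ 0 := by
      rintro rfl
      rw [Matrix.rank_zero] at hr
      omega
    obtain ⟨r, s, h'⟩ := ev_exists I hI0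
    have r2 := evR_rank_ge I r s
    obtain ⟨Y, hY⟩ := ih (evR I r s) (evR_symm I r s hI) (evR_even I r s hIe)
      (evR A p q) (evR_symm A p q hA) (evR_even A p q hAe) (by omega) (by omega)
    obtain ⟨Z, hZ⟩ := ev_step I r s hI hIe h' Y (A * evE p q)
    refine ⟨Z, ?_⟩
    rw [hZ, ← hY, evR, add_assoc, ev_add_self, add_zero]

/-- If `I` is an even symmetric `m × m` matrix over `𝔽₂` and `A` is
an even symmetric `n × n` matrix over `𝔽₂` with `rank A ≤ rank I`, then
`A = Yᵀ * I * Y` for some `m × n` matrix `Y`. -/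
theorem even_matrix_conjugate_of_rank_le {m n : ℕ}
    (I : Matrix (Fin m) (Fin m) (ZMod 2)) (hI : I.IsSymm)
    (hIeven : ∀ i, I i i = 0)
    (A : Matrix (Fin n) (Fin n) (ZMod 2)) (hA : A.IsSymm)
    (hAeven : ∀ i, A i i = 0)
    (hrk : A.rank ≤ I.rank) :
    ∃ Y : Matrix (Fin m) (Fin n) (ZMod 2), A = Yᵀ * I * Y := by
  exact ev_main A.rank I hI hIeven A hA hAeven hrk le_rfl
end

section
/- Let I be a symmetric m×m matrix over 𝔽₂ that is odd, i.e. some diagonal entry of I is nonzero, and let A be a symmetric n×n matrix over 𝔽₂ that is odd and satisfies rank A ≤ rank I. Then there exists an m×n matrix Y over 𝔽₂ such that A = Yᵀ · I · Y. -/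
open Matrix

lemma zm2_cases (a : ZMod 2) : a = 0 ∨ a = 1 := by
  revert a; decide

lemma zm2_sq (a : ZMod 2) : a * a = a := by
  revert a; decide

lemma q_add {n : ℕ} (A : Matrix (Fin n) (Fin n) (ZMod 2)) (hA : A.IsSymm)
    (x y : Fin n → ZMod 2) :
    (x + y) ⬝ᵥ (A *ᵥ (x + y)) = x ⬝ᵥ (A *ᵥ x) + y ⬝ᵥ (A *ᵥ y) := by
  have h : y ⬝ᵥ (A *ᵥ x) = x ⬝ᵥ (A *ᵥ y) := by
    rw [dotProduct_comm, Matrix.dotProduct_mulVec x, ← Matrix.mulVec_transpose, hA.eq]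
  rw [mulVec_add, add_dotProduct, dotProduct_add, dotProduct_add, h]
  have := CharTwo.add_self_eq_zero (x ⬝ᵥ (A *ᵥ y))
  linear_combination this

lemma deflate_mulVec {n : ℕ} (A : Matrix (Fin n) (Fin n) (ZMod 2))
    (a z : Fin n → ZMod 2) :
    (A - vecMulVec a a) *ᵥ z = A *ᵥ z - (a ⬝ᵥ z) • a := by
  rw [sub_mulVec, vecMulVec_mulVec]
  ext i; simp [mul_comm]

lemma deflate_rank {n : ℕ} (A : Matrix (Fin n) (Fin n) (ZMod 2)) (hA : A.IsSymm)
    (x : Fin n → ZMod 2) (hx : x ⬝ᵥ (A *ᵥ x) = 1) :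
    (A - vecMulVec (A *ᵥ x) (A *ᵥ x)).rank < A.rank := by
  have hs : ∀ z, (A *ᵥ x) ⬝ᵥ z = x ⬝ᵥ (A *ᵥ z) := fun z => by
    rw [Matrix.dotProduct_mulVec x, ← Matrix.mulVec_transpose, hA.eq]
  have hlt : LinearMap.ker A.mulVecLin <
      LinearMap.ker (A - vecMulVec (A *ᵥ x) (A *ᵥ x)).mulVecLin := by
    refine lt_of_le_of_ne ?_ ?_
    · intro z hz
      rw [LinearMap.mem_ker, mulVecLin_apply] at *
      rw [deflate_mulVec, hs, hz]; simp
    · intro h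
      have : x ∈ LinearMap.ker A.mulVecLin := by
        rw [h, LinearMap.mem_ker, mulVecLin_apply, deflate_mulVec, hs, hx]; simp
      rw [LinearMap.mem_ker, mulVecLin_apply] at this
      rw [this] at hx; simp at hx
  have h1 := Submodule.finrank_lt_finrank_of_lt hlt
  have h2 := LinearMap.finrank_range_add_finrank_ker A.mulVecLin
  have h3 := LinearMap.finrank_range_add_finrank_ker
    (A - vecMulVec (A *ᵥ x) (A *ᵥ x)).mulVecLin
  unfold Matrix.rank
  omega

lemma exists_deflate {n : ℕ} (A : Matrix (Fin n) (Fin n) (ZMod 2)) (hA : A.IsSymm)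
    (hodd : ∃ i, A i i ≠ 0) :
    ∃ x : Fin n → ZMod 2, x ⬝ᵥ (A *ᵥ x) = 1 ∧
      ((∃ i, (A - vecMulVec (A *ᵥ x) (A *ᵥ x)) i i ≠ 0) ∨
        A - vecMulVec (A *ᵥ x) (A *ᵥ x) = 0) := by
  by_contra! hcon
  obtain ⟨i, hi⟩ := hodd
  have hd : ∀ x : Fin n → ZMod 2, x ⬝ᵥ (A *ᵥ x) = 1 → A *ᵥ x = fun j => A j j := by
    intro x hx
    ext j
    have := (hcon x hx).1 j
    rw [Matrix.sub_apply, vecMulVec_apply, zm2_sq, sub_eq_zero] at this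
    exact this.symm
  set e : Fin n → ZMod 2 := Pi.single i 1 with he
  have hq : e ⬝ᵥ (A *ᵥ e) = 1 := by
    rcases zm2_cases (A i i) with h | h
    · exact absurd h hi
    · simp [he, h]
  have hs : ∀ z, (A *ᵥ e) ⬝ᵥ z = e ⬝ᵥ (A *ᵥ z) := fun z => by
    rw [Matrix.dotProduct_mulVec e, ← Matrix.mulVec_transpose, hA.eq]
  apply (hcon e hq).2
  have key : ∀ z, (A - vecMulVec (A *ᵥ e) (A *ᵥ e)) *ᵥ z = 0 := by
    intro z
    rw [deflate_mulVec, hs]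
    rcases zm2_cases (z ⬝ᵥ (A *ᵥ z)) with h | h
    · have h1 := hd (e + z) (by rw [q_add A hA, hq, h, add_zero])
      rw [mulVec_add, hd e hq, add_eq_left] at h1
      rw [h1]; simp
    · have h1 : A *ᵥ z = A *ᵥ e := by rw [hd z h, hd e hq]
      rw [h1, hq]; simp
  ext a b
  have := congrFun (key (Pi.single b 1)) a
  simpa using this

lemma exists_factor {n : ℕ} (k : ℕ) : ∀ (A : Matrix (Fin n) (Fin n) (ZMod 2)), A.IsSymm →
    ((∃ i, A i i ≠ 0) ∨ A = 0) → A.rank ≤ k →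
    ∃ Z : Matrix (Fin k) (Fin n) (ZMod 2), A = Zᵀ * Z := by
  induction k with
  | zero =>
    intro A hA _ hr
    have h0 : A = 0 := by
      have : A.rank = 0 := by omega
      unfold Matrix.rank at this
      rw [Submodule.finrank_eq_zero, LinearMap.range_eq_bot] at this
      ext a b
      have h := congrFun (LinearMap.congr_fun this (Pi.single b 1)) a
      simpa using h
    exact ⟨0, by simp [h0]⟩
  | succ k ih =>
    intro A hA hodd hr
    rcases hodd with hodd | h0
    · obtain ⟨x, hx, hx'⟩ := exists_deflate A hA hodd
      have hlt := deflate_rank A hA x hx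
      obtain ⟨Z, hZ⟩ := ih (A - vecMulVec (A *ᵥ x) (A *ᵥ x))
        (by
          unfold Matrix.IsSymm
          rw [transpose_sub, hA.eq, transpose_vecMulVec]) hx' (by omega)
      refine ⟨Matrix.of (Fin.cons (A *ᵥ x) Z), ?_⟩
      ext a b
      have h := congrFun (congrFun hZ a) b
      rw [Matrix.sub_apply, vecMulVec_apply, mul_apply] at h
      rw [mul_apply, Fin.sum_univ_succ]
      simp only [transpose_apply] at h
      change A a b = (A *ᵥ x) a * (A *ᵥ x) b + ∑ j, Z j a * Z j b
      rw [← h]; ring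
    · exact ⟨0, by simp [h0]⟩

/-- If `I` is an odd symmetric `m × m` matrix over `𝔽₂` and `A` is
an odd symmetric `n × n` matrix over `𝔽₂` with `rank A ≤ rank I`, then
`A = Yᵀ * I * Y` for some `m × n` matrix `Y`. -/
theorem odd_matrix_conjugate_of_rank_le {m n : ℕ}
    (I : Matrix (Fin m) (Fin m) (ZMod 2)) (hI : I.IsSymm)
    (hIodd : ∃ i, I i i ≠ 0)
    (A : Matrix (Fin n) (Fin n) (ZMod 2)) (hA : A.IsSymm)
    (hAodd : ∃ i, A i i ≠ 0)
    (hrk : A.rank ≤ I.rank) :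
    ∃ Y : Matrix (Fin m) (Fin n) (ZMod 2), A = Yᵀ * I * Y := by
  obtain ⟨Z, hZ⟩ := exists_factor I.rank I hI (Or.inl hIodd) le_rfl
  obtain ⟨X, hX⟩ := exists_factor I.rank A hA (Or.inl hAodd) hrk
  have h1 : I.rank ≤ Z.rank := by
    have := Matrix.rank_mul_le_right Zᵀ Z
    rwa [← hZ] at this
  have hsurj : LinearMap.range Z.mulVecLin = ⊤ := by
    apply Submodule.eq_top_of_finrank_eq
    apply le_antisymm (Submodule.finrank_le _)
    rw [Module.finrank_fin_fun]
    exact h1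
  have hW : ∀ j : Fin I.rank, ∃ w, Z *ᵥ w = Pi.single j 1 := fun j => by
    have := LinearMap.range_eq_top.1 hsurj (Pi.single j 1)
    simpa using this
  choose w hw using hW
  have hZW : Z * (Matrix.of w)ᵀ = 1 := by
    ext a b
    have := congrFun (hw b) a
    rw [one_apply, mul_apply]
    simpa [mulVec, dotProduct, Pi.single_apply] using this
  generalize (Matrix.of w)ᵀ = W at hZW
  refine ⟨W * X, ?_⟩
  have e : (W * X)ᵀ * (Zᵀ * Z) * (W * X) = Xᵀ * ((Z * W)ᵀ * (Z * W)) * X := by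
    simp only [transpose_mul, Matrix.mul_assoc]
  rw [hZW] at e
  rw [show (W * X)ᵀ * I * (W * X) = (W * X)ᵀ * (Zᵀ * Z) * (W * X) from
    congrArg (fun M => (W * X)ᵀ * M * (W * X)) hZ, e, hX]
  simp
end

section
/- Let A be a skew-symmetric n×n matrix with integer entries (i.e. Aᵀ = −A) and let g be a natural number. Then there exists a 2g×n matrix Y with integer entries such that A = Yᵀ · H_{g,ℤ} · Y if and only if the rank of A over ℚ is at most 2g. -/
open Matrix

theorem aux_step_s11 {g n : ℕ} (Y : Matrix (Fin (2 * g)) (Fin n) ℤ) (p q : Fin n → ℤ) :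
    ∃ Y' : Matrix (Fin (2 * (g + 1))) (Fin n) ℤ, ∀ i j,
      (Y'ᵀ * HgZ (g + 1) * Y') i j = (Yᵀ * HgZ g * Y) i j + (p i * q j - q i * p j) := by
  let z : Fin (2 * (g + 1)) := ⟨0, by omega⟩
  let o : Fin (2 * (g + 1)) := ⟨1, by omega⟩
  let s : Fin (2 * g) → Fin (2 * (g + 1)) := fun a => ⟨a.val + 2, by omega⟩
  obtain ⟨Y', y0, y1, ys⟩ : ∃ Y' : Matrix (Fin (2 * (g + 1))) (Fin n) ℤ,
      (∀ i, Y' z i = p i) ∧ (∀ i, Y' o i = q i) ∧ (∀ a i, Y' (s a) i = Y a i) := by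
    refine ⟨Matrix.of fun a i => if a.val = 0 then p i else if a.val = 1 then q i else
      if h : a.val - 2 < 2 * g then Y ⟨a.val - 2, h⟩ i else 0, ?_, fun i => rfl, ?_⟩ <;> simp [z, s]
  refine ⟨Y', fun i j => ?_⟩
  simp only [Matrix.mul_apply, Matrix.transpose_apply]
  have e : ∀ F : Fin (2 * (g + 1)) → ℤ, ∑ a, F a = F z + (F o + ∑ a, F (s a)) := by
    intro F
    have h1 := Fin.sum_univ_succ (n := 2 * g + 1) F
    have h2 := Fin.sum_univ_succ (n := 2 * g) (fun a => F (Fin.succ a : Fin (2 * g + 2)))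
    exact h1.trans (congrArg (fun t => F z + t) h2)
  have h00 : HgZ (g + 1) z z = 0 := by
    simp [HgZ]
  have h01 : HgZ (g + 1) z o = 1 := by
    simp only [HgZ, Matrix.of_apply, z, o]
    rfl
  have h10 : HgZ (g + 1) o z = -1 := by
    simp only [HgZ, Matrix.of_apply, z, o]
    rfl
  have h11 : HgZ (g + 1) o o = 0 := by
    simp [HgZ]
  have h0s : ∀ a : Fin (2 * g), HgZ (g + 1) z (s a) = 0 := by
    intro a
    simp only [HgZ, Matrix.of_apply, z, s]
    split_ifs <;> omega
  have hs0 : ∀ a : Fin (2 * g), HgZ (g + 1) (s a) z = 0 := by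
    intro a
    simp only [HgZ, Matrix.of_apply, z, s]
    split_ifs <;> omega
  have h1s : ∀ a : Fin (2 * g), HgZ (g + 1) o (s a) = 0 := by
    intro a
    simp only [HgZ, Matrix.of_apply, o, s]
    split_ifs <;> omega
  have hs1 : ∀ a : Fin (2 * g), HgZ (g + 1) (s a) o = 0 := by
    intro a
    simp only [HgZ, Matrix.of_apply, o, s]
    split_ifs <;> omega
  have hss : ∀ a b : Fin (2 * g), HgZ (g + 1) (s a) (s b) = HgZ g a b := by
    intro a b
    simp only [HgZ, Matrix.of_apply, s]
    split_ifs <;> omega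
  simp only [e, h00, h01, h10, h11, h0s, hs0, h1s, hs1, hss, y0, y1, ys]
  simp only [mul_zero, Finset.sum_const_zero]
  ring_nf

theorem aux_finrank {V : Type*} [AddCommGroup V] [Module ℚ V] [FiniteDimensional ℚ V]
    (R' R : Submodule ℚ V) (h : R' ≤ R) (T : V →ₗ[ℚ] (ℚ × ℚ)) (hk : R' ≤ LinearMap.ker T)
    (a b : V) (ha : a ∈ R) (hb : b ∈ R) (d : ℚ) (hd : d ≠ 0)
    (hTa : T a = (d, 0)) (hTb : T b = (0, -d)) :
    Module.finrank ℚ R' + 2 ≤ Module.finrank ℚ R := by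
  have h1 := (T.domRestrict R).finrank_range_add_finrank_ker
  have hs : LinearMap.range (T.domRestrict R) = ⊤ := by
    rw [LinearMap.range_eq_top]
    rintro ⟨x, y⟩
    refine ⟨(x / d) • ⟨a, ha⟩ - (y / d) • ⟨b, hb⟩, ?_⟩
    rw [map_sub, map_smul, map_smul, LinearMap.domRestrict_apply, LinearMap.domRestrict_apply,
      hTa, hTb]
    ext <;> simp <;> field_simp
  rw [hs, finrank_top] at h1
  have h2 : Module.finrank ℚ R' ≤ Module.finrank ℚ (LinearMap.ker (T.domRestrict R)) := by
    let f : R' →ₗ[ℚ] LinearMap.ker (T.domRestrict R) :=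
      (Submodule.inclusion h).codRestrict _ (fun x => hk x.2)
    apply LinearMap.finrank_le_finrank_of_injective (f := f)
    intro x y hxy
    apply Subtype.ext
    exact congrArg (fun z : LinearMap.ker (T.domRestrict R) => ((z : R) : V)) hxy
  simp at h1
  omega

theorem aux_rank_s11 {n : ℕ} (A A' : Matrix (Fin n) (Fin n) ℚ) (M : Matrix (Fin n) (Fin n) ℚ)
    (hM : A' = A * M) (u v : Fin n → ℚ) (hu : u ᵥ* A' = 0) (hv : v ᵥ* A' = 0)
    (d : ℚ) (hd : d ≠ 0) (huv : u ⬝ᵥ (A *ᵥ v) = d) (hvu : v ⬝ᵥ (A *ᵥ u) = -d)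
    (huu : u ⬝ᵥ (A *ᵥ u) = 0) (hvv : v ⬝ᵥ (A *ᵥ v) = 0) :
    A'.rank + 2 ≤ A.rank := by
  let T : (Fin n → ℚ) →ₗ[ℚ] (ℚ × ℚ) :=
    LinearMap.prod (dotProductBilin ℚ ℚ u) (dotProductBilin ℚ ℚ v)
  have hT : ∀ x, T x = (u ⬝ᵥ x, v ⬝ᵥ x) := fun x => rfl
  refine aux_finrank (LinearMap.range A'.mulVecLin) (LinearMap.range A.mulVecLin) ?_ T ?_
    (A *ᵥ v) (A *ᵥ u) ⟨v, rfl⟩ ⟨u, rfl⟩ d hd (by rw [hT, huv, hvv]) (by rw [hT, huu, hvu])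
  · rintro _ ⟨x, rfl⟩
    exact ⟨M *ᵥ x, by simp [hM]⟩
  · rintro _ ⟨x, rfl⟩
    rw [LinearMap.mem_ker, hT]
    simp [Matrix.dotProduct_mulVec, hu, hv]

theorem aux_skew {n : ℕ} (A : Matrix (Fin n) (Fin n) ℤ) (hA : Aᵀ = -A) (x y : Fin n → ℤ) :
    x ⬝ᵥ (A *ᵥ y) = - (y ⬝ᵥ (A *ᵥ x)) := by
  rw [Matrix.dotProduct_mulVec, ← Matrix.mulVec_transpose, hA, dotProduct_comm,
    Matrix.neg_mulVec, dotProduct_neg]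

theorem aux_min {n : ℕ} (A : Matrix (Fin n) (Fin n) ℤ) (h0 : A ≠ 0) :
    ∃ (u v : Fin n → ℤ) (d : ℤ), d ≠ 0 ∧ u ⬝ᵥ (A *ᵥ v) = d ∧
      (∀ y, d ∣ u ⬝ᵥ (A *ᵥ y)) ∧ (∀ x, d ∣ x ⬝ᵥ (A *ᵥ v)) := by
  classical
  have hex : ∃ m : ℕ, 0 < m ∧ ∃ u v : Fin n → ℤ, u ⬝ᵥ (A *ᵥ v) = m := by
    obtain ⟨i, j, hij⟩ : ∃ i j, A i j ≠ 0 := by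
      by_contra! h
      exact h0 (Matrix.ext h)
    have hv : ∀ c : ℤ, (Pi.single i c) ⬝ᵥ (A *ᵥ Pi.single j 1) = c * A i j := by
      intro c
      simp
    refine ⟨(A i j).natAbs, by omega, Pi.single i (A i j).sign, Pi.single j 1, ?_⟩
    rw [hv, Int.sign_mul_self_eq_natAbs]
  obtain ⟨hpos, u, v, huv⟩ := Nat.find_spec hex
  have hmin := fun m (hm : m < Nat.find hex) => Nat.find_min hex hm
  set m := Nat.find hex
  have key : ∀ x y : Fin n → ℤ, ∀ r : ℤ, x ⬝ᵥ (A *ᵥ y) = r → 0 ≤ r → r < m → r = 0 := by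
    intro x y r h h1 h2
    by_contra h3
    exact hmin r.toNat (by omega) ⟨by omega, x, y, by omega⟩
  refine ⟨u, v, m, by omega, huv, fun y => ?_, fun x => ?_⟩
  · refine Int.dvd_of_emod_eq_zero (key u (y - ((u ⬝ᵥ (A *ᵥ y)) / m) • v) _ ?_
      (Int.emod_nonneg _ (by omega)) (Int.emod_lt_of_pos _ (by omega)))
    rw [Matrix.mulVec_sub, Matrix.mulVec_smul, dotProduct_sub, dotProduct_smul, huv,
      Int.emod_def, smul_eq_mul, mul_comm]
  · refine Int.dvd_of_emod_eq_zero (key (x - ((x ⬝ᵥ (A *ᵥ v)) / m) • u) v _ ?_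
      (Int.emod_nonneg _ (by omega)) (Int.emod_lt_of_pos _ (by omega)))
    rw [sub_dotProduct, smul_dotProduct, huv, Int.emod_def, smul_eq_mul, mul_comm]

theorem aux_reduce {n : ℕ} (A : Matrix (Fin n) (Fin n) ℤ) (hA : Aᵀ = -A) (h0 : A ≠ 0) :
    ∃ (A' : Matrix (Fin n) (Fin n) ℤ) (p q : Fin n → ℤ), A'ᵀ = -A' ∧
      (∀ i j, A i j = A' i j + (p i * q j - q i * p j)) ∧ rankQ A' + 2 ≤ rankQ A := by
  classical
  obtain ⟨u, v, d, hd, huv, h1, h2⟩ := aux_min A h0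
  have hp : ∃ p : Fin n → ℤ, A *ᵥ v = d • p := by
    choose p hp using fun i => h2 (Pi.single i 1)
    refine ⟨p, funext fun i => ?_⟩
    simpa using hp i
  have hq : ∃ q : Fin n → ℤ, u ᵥ* A = d • q := by
    choose q hq using fun i => h1 (Pi.single i 1)
    refine ⟨q, funext fun i => ?_⟩
    have := hq i
    rw [Matrix.dotProduct_mulVec] at this
    simpa using this
  obtain ⟨p, hp⟩ := hp
  obtain ⟨q, hq⟩ := hq
  have hu' : A *ᵥ u = -(d • q) := by
    rw [← hq, ← Matrix.mulVec_transpose, hA, Matrix.neg_mulVec, neg_neg]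
  have hv' : v ᵥ* A = -(d • p) := by
    rw [← hp, ← Matrix.mulVec_transpose, hA, Matrix.neg_mulVec]
  have huu : u ⬝ᵥ (A *ᵥ u) = 0 := by have := aux_skew A hA u u; omega
  have hvv : v ⬝ᵥ (A *ᵥ v) = 0 := by have := aux_skew A hA v v; omega
  have hvu : v ⬝ᵥ (A *ᵥ u) = -d := by rw [aux_skew A hA v u, huv]
  have hup : u ⬝ᵥ p = 1 := by
    rw [hp, dotProduct_smul, smul_eq_mul] at huv
    exact mul_left_cancel₀ hd (by rw [huv, mul_one])
  have hvp : v ⬝ᵥ p = 0 := by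
    rw [hp, dotProduct_smul, smul_eq_mul] at hvv
    exact mul_left_cancel₀ hd (by rw [hvv, mul_zero])
  have huq : u ⬝ᵥ q = 0 := by
    rw [hu', dotProduct_neg, dotProduct_smul, smul_eq_mul] at huu
    exact mul_left_cancel₀ hd (by linarith)
  have hvq : v ⬝ᵥ q = 1 := by
    rw [hu', dotProduct_neg, dotProduct_smul, smul_eq_mul] at hvu
    exact mul_left_cancel₀ hd (by linarith)
  let M : Matrix (Fin n) (Fin n) ℤ := 1 - (vecMulVec v q + vecMulVec u p)
  have hM : ∀ i j, (A * M) i j = A i j - (d * p i * q j - d * q i * p j) := by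
    intro i j
    simp only [M, Matrix.mul_sub, Matrix.mul_add, Matrix.mul_one, Matrix.mul_vecMulVec, hp, hu']
    simp [vecMulVec_apply]
    ring
  have huM : u ᵥ* (A * M) = 0 := by
    rw [← Matrix.vecMul_vecMul, hq]
    simp only [M, Matrix.vecMul_sub, Matrix.vecMul_add, Matrix.vecMul_vecMulVec, smul_dotProduct,
      neg_dotProduct, dotProduct_comm q, huq, hvq, Matrix.vecMul_one]
    ext i
    simp
  have hvM : v ᵥ* (A * M) = 0 := by
    rw [← Matrix.vecMul_vecMul, hv']
    simp only [M, Matrix.vecMul_sub, Matrix.vecMul_add, Matrix.vecMul_vecMulVec, smul_dotProduct,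
      neg_dotProduct, dotProduct_comm p, hup, hvp, Matrix.vecMul_one]
    ext i
    simp
  refine ⟨A * M, d • p, q, ?_, ?_, ?_⟩
  · ext i j
    have := congrFun (congrFun hA i) j
    rw [Matrix.transpose_apply, Matrix.neg_apply] at this ⊢
    rw [hM, hM, this]
    ring
  · intro i j
    rw [hM]
    simp
    ring
  · have cd : ∀ x y : Fin n → ℤ, (fun i => (x i : ℚ)) ⬝ᵥ (fun i => (y i : ℚ)) =
        ((x ⬝ᵥ y : ℤ) : ℚ) := by
      intro x y; simp [dotProduct]
    have cm : ∀ y : Fin n → ℤ, (A.map (Int.cast : ℤ → ℚ)) *ᵥ (fun i => (y i : ℚ)) =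
        fun i => (((A *ᵥ y) i : ℤ) : ℚ) := by
      intro y; ext i; simp [Matrix.mulVec, dotProduct]
    have cv : ∀ (B : Matrix (Fin n) (Fin n) ℤ) (y : Fin n → ℤ), y ᵥ* B = 0 →
        (fun i => (y i : ℚ)) ᵥ* (B.map (Int.cast : ℤ → ℚ)) = 0 := by
      intro B y h
      ext i
      have := congrFun h i
      simp only [Matrix.vecMul, dotProduct, Matrix.map_apply, Pi.zero_apply] at this ⊢
      exact_mod_cast this
    refine aux_rank_s11 (A.map Int.cast) ((A * M).map Int.cast) (M.map Int.cast) ?_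
      (fun i => (u i : ℚ)) (fun i => (v i : ℚ)) (cv _ _ huM) (cv _ _ hvM) d
      (by exact_mod_cast hd) ?_ ?_ ?_ ?_
    · ext i j; simp [Matrix.mul_apply]
    · rw [cm, cd, huv]
    · rw [cm, cd, hvu]; simp
    · rw [cm, cd, huu]; simp
    · rw [cm, cd, hvv]; simp

theorem aux_exists {n : ℕ} (g : ℕ) : ∀ (A : Matrix (Fin n) (Fin n) ℤ), Aᵀ = -A →
    rankQ A ≤ 2 * g → ∃ Y : Matrix (Fin (2 * g)) (Fin n) ℤ, A = Yᵀ * HgZ g * Y := by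
  induction g with
  | zero =>
    intro A hA h
    by_cases h0 : A = 0
    · exact ⟨0, by simp [h0]⟩
    · obtain ⟨A', p, q, -, -, h3⟩ := aux_reduce A hA h0
      omega
  | succ g ih =>
    intro A hA h
    by_cases h0 : A = 0
    · exact ⟨0, by simp [h0]⟩
    · obtain ⟨A', p, q, h1, h2, h3⟩ := aux_reduce A hA h0
      obtain ⟨Y, hY⟩ := ih A' h1 (by omega)
      obtain ⟨Y', hY'⟩ := aux_step_s11 Y p q
      exact ⟨Y', by ext i j; rw [hY', ← hY, h2]⟩

/-- A skew-symmetric integer `n × n` matrix `A` can be written as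
`A = Yᵀ * H_{g,ℤ} * Y` for some `2g × n` integer matrix `Y` if and only if the
rank of `A` over `ℚ` is at most `2g`. -/
theorem skew_symm_int_conjugate_HgZ_iff {n : ℕ}
    (A : Matrix (Fin n) (Fin n) ℤ) (hA : Aᵀ = -A) (g : ℕ) :
    (∃ Y : Matrix (Fin (2 * g)) (Fin n) ℤ, A = Yᵀ * HgZ g * Y) ↔
      rankQ A ≤ 2 * g := by
  refine ⟨?_, aux_exists g A hA⟩
  rintro ⟨Y, rfl⟩
  have : (Yᵀ * HgZ g * Y).map (Int.cast : ℤ → ℚ) =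
      (Yᵀ * HgZ g).map (Int.cast : ℤ → ℚ) * Y.map (Int.cast : ℤ → ℚ) := by
    ext i j
    simp [Matrix.mul_apply]
  rw [rankQ, this]
  refine (Matrix.rank_mul_le_left _ _).trans ?_
  simpa using Matrix.rank_le_card_width ((Yᵀ * HgZ g).map (Int.cast : ℤ → ℚ))
end
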